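/- arXiv:0910.1532 — 4 statements merged into one kernel-verified Lean document; each statement's English description precedes it below -/
import Mathlib

section
/- Let γ(x) = (1/2)·log(1+x). Fix b > 0, P_p ≥ 0 and S > 0, and set σ² = 1 + (1+b²)·P_p. Then the supremum, over all P_{c1}, P_{c2} ≥ 0 with P_{c1} + P_{c2} ≤ S, of min{ γ((√P_{c1} + b√P_{c2})²/σ²), γ((√P_{c2} + b√P_{c1})²/σ²), (1/2)·γ(((√P_{c1} + b√P_{c2})² + (√P_{c2} + b√P_{c1})²)/σ²) } equals (1/2)·γ((1+b)²·S/σ²), and this value is attained at P_{c1} = P_{c2} = S/2. -/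
noncomputable def gamma (x : ℝ) : ℝ := (1 / 2) * Real.log (1 + x)

theorem gamma_le_gamma {x y : ℝ} (hx : 0 ≤ x) (hxy : x ≤ y) : gamma x ≤ gamma y := by
  unfold gamma
  have := Real.log_le_log (by linarith : 0 < 1 + x) (by linarith : 1 + x ≤ 1 + y)
  linarith

theorem half_gamma_add_self_le {x : ℝ} (hx : 0 ≤ x) : (1 / 2) * gamma (x + x) ≤ gamma x := by
  unfold gamma
  have h : Real.log (1 + (x + x)) ≤ Real.log ((1 + x) ^ 2) :=
    Real.log_le_log (by linarith) (by nlinarith [sq_nonneg x])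
  rw [Real.log_pow] at h
  push_cast at h
  linarith

theorem sum_sq_sqrt_le {b p q : ℝ} (hb : 0 ≤ b) (hp : 0 ≤ p) (hq : 0 ≤ q) :
    (√p + b * √q) ^ 2 + (√q + b * √p) ^ 2 ≤ (1 + b) ^ 2 * (p + q) := by
  have h := mul_nonneg hb (sq_nonneg (√p - √q))
  nlinarith [Real.sq_sqrt hp, Real.sq_sqrt hq]

theorem min_gamma_equal_split (b : ℝ) {S σ2 : ℝ} (hS : 0 ≤ S) (hσ : 0 ≤ σ2) :
    min (min (gamma ((√(S / 2) + b * √(S / 2)) ^ 2 / σ2))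
              (gamma ((√(S / 2) + b * √(S / 2)) ^ 2 / σ2)))
        ((1 / 2) * gamma (((√(S / 2) + b * √(S / 2)) ^ 2
            + (√(S / 2) + b * √(S / 2)) ^ 2) / σ2))
      = (1 / 2) * gamma ((1 + b) ^ 2 * S / σ2) := by
  have hsq : (√(S / 2) + b * √(S / 2)) ^ 2 = (1 + b) ^ 2 * S / 2 := by
    have h := Real.sq_sqrt (by linarith : 0 ≤ S / 2)
    linear_combination (1 + b) ^ 2 * h
  have hx : 0 ≤ (1 + b) ^ 2 * S / 2 / σ2 := by positivity
  rw [hsq, min_self, add_div, min_eq_right (half_gamma_add_self_le hx)]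
  congr 2
  ring

/-- The symmetric common-message rate of the second-hop MAC scheme:
the sup over power splits `Pc1 + Pc2 ≤ S` of the min of the two single-user
bounds and half the sum-rate bound equals `(1/2) γ((1+b)² S / σ²)`,
attained at the equal split `Pc1 = Pc2 = S/2`. -/
theorem stmt_0 (b Pp S : ℝ) (hb : 0 < b) (hPp : 0 ≤ Pp) (hS : 0 < S)
    (σ2 : ℝ) (hσ2 : σ2 = 1 + (1 + b ^ 2) * Pp) :
    IsGreatest
      { r : ℝ | ∃ Pc1 Pc2 : ℝ, 0 ≤ Pc1 ∧ 0 ≤ Pc2 ∧ Pc1 + Pc2 ≤ S ∧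
          r = min (min (gamma ((Real.sqrt Pc1 + b * Real.sqrt Pc2) ^ 2 / σ2))
                        (gamma ((Real.sqrt Pc2 + b * Real.sqrt Pc1) ^ 2 / σ2)))
                  ((1 / 2) * gamma (((Real.sqrt Pc1 + b * Real.sqrt Pc2) ^ 2
                      + (Real.sqrt Pc2 + b * Real.sqrt Pc1) ^ 2) / σ2)) }
      ((1 / 2) * gamma ((1 + b) ^ 2 * S / σ2))
    ∧
    min (min (gamma ((Real.sqrt (S / 2) + b * Real.sqrt (S / 2)) ^ 2 / σ2))
              (gamma ((Real.sqrt (S / 2) + b * Real.sqrt (S / 2)) ^ 2 / σ2)))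
        ((1 / 2) * gamma (((Real.sqrt (S / 2) + b * Real.sqrt (S / 2)) ^ 2
            + (Real.sqrt (S / 2) + b * Real.sqrt (S / 2)) ^ 2) / σ2))
      = (1 / 2) * gamma ((1 + b) ^ 2 * S / σ2) := by
  have hσ : 0 < σ2 := by rw [hσ2]; positivity
  have hsplit := min_gamma_equal_split b hS.le hσ.le
  refine ⟨⟨⟨S / 2, S / 2, by positivity, by positivity, by linarith, hsplit.symm⟩, ?_⟩, hsplit⟩
  rintro r ⟨p, q, hp, hq, hpq, rfl⟩
  refine (min_le_right _ _).trans ?_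
  have hsum := (sum_sq_sqrt_le hb.le hp hq).trans
    (mul_le_mul_of_nonneg_left hpq (sq_nonneg (1 + b)))
  have hγ := gamma_le_gamma (by positivity) (div_le_div_of_nonneg_right hsum hσ.le)
  linarith
end

section
/- Let γ(x) = (1/2)·log(1+x) and, for 0 < a < 1, define L(a) = (1 + 4a² − a⁴ + √((1 + 4a² − a⁴)² + 4a²(1 − a²)²)) / (2a²(1 − a²)²). Then for every 0 < a < 1 and every P > 0, the inequality γ((1 − a²)²·P²/((1 + a²)·2P + 1)) > γ(P/(1 + a²·P)) holds if and only if P > L(a). -/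
noncomputable def L (a : ℝ) : ℝ :=
  (1 + 4 * a ^ 2 - a ^ 4
      + Real.sqrt ((1 + 4 * a ^ 2 - a ^ 4) ^ 2 + 4 * a ^ 2 * (1 - a ^ 2) ^ 2))
    / (2 * a ^ 2 * (1 - a ^ 2) ^ 2)

theorem gamma_lt_gamma_iff {x y : ℝ} (hx : 0 < x) (hy : 0 < y) :
    gamma x < gamma y ↔ x < y := by
  unfold gamma
  rw [mul_lt_mul_iff_right₀ (by norm_num), Real.log_lt_log_iff (by linarith) (by linarith),
    add_lt_add_iff_left]

/-- A positive number exceeds the positive root of `A * x ^ 2 - B * x - 1` exactly when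
the quadratic is positive there. -/
theorem quadratic_root_lt_iff {A B x : ℝ} (hA : 0 < A) (hx : 0 < x) :
    (B + √(B ^ 2 + 4 * A)) / (2 * A) < x ↔ 0 < A * x ^ 2 - B * x - 1 := by
  have hD : 0 ≤ B ^ 2 + 4 * A := by positivity
  have hB : B ≤ √(B ^ 2 + 4 * A) := Real.le_sqrt_of_sq_le (by linarith)
  have hAx : 0 < A * x := mul_pos hA hx
  have hpos : 0 < 2 * A * x - B + √(B ^ 2 + 4 * A) := by linarith
  have hfactor : (2 * A * x - B - √(B ^ 2 + 4 * A)) * (2 * A * x - B + √(B ^ 2 + 4 * A))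
      = 4 * A * (A * x ^ 2 - B * x - 1) := by
    linear_combination -Real.sq_sqrt hD
  rw [div_lt_iff₀ (by positivity), ← mul_pos_iff_of_pos_left (by positivity : 0 < 4 * A),
    ← hfactor, mul_pos_iff_of_pos_right hpos]
  constructor <;> intro h <;> linarith

/-- For `0 < a < 1` and `P > 0`, the out-of-phase amplify-and-forward rate
exceeds the single-hop noisy-interference symmetric capacity iff `P > L a`. -/
theorem stmt_7 (a P : ℝ) (ha0 : 0 < a) (ha1 : a < 1) (hP : 0 < P) :
    gamma ((1 - a ^ 2) ^ 2 * P ^ 2 / ((1 + a ^ 2) * (2 * P) + 1))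
        > gamma (P / (1 + a ^ 2 * P))
      ↔ P > L a := by
  have ha : a ^ 2 < 1 := pow_lt_one₀ ha0.le ha1 two_ne_zero
  have hsub : 0 < 1 - a ^ 2 := sub_pos.mpr ha
  have hL : L a = ((1 + 4 * a ^ 2 - a ^ 4)
      + √((1 + 4 * a ^ 2 - a ^ 4) ^ 2 + 4 * (a ^ 2 * (1 - a ^ 2) ^ 2)))
        / (2 * (a ^ 2 * (1 - a ^ 2) ^ 2)) := by
    simp only [L, mul_assoc]
  have hdiff : (1 - a ^ 2) ^ 2 * P ^ 2 * (1 + a ^ 2 * P) - P * ((1 + a ^ 2) * (2 * P) + 1)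
      = P * (a ^ 2 * (1 - a ^ 2) ^ 2 * P ^ 2 - (1 + 4 * a ^ 2 - a ^ 4) * P - 1) := by
    ring
  rw [gt_iff_lt, gt_iff_lt, hL, quadratic_root_lt_iff (by positivity) hP,
    gamma_lt_gamma_iff (by positivity) (by positivity),
    div_lt_div_iff₀ (by positivity) (by positivity), ← sub_pos, hdiff,
    mul_pos_iff_of_pos_left hP]
end

section
/- For 0 < a < 1, define L(a) = (1 + 4a² − a⁴ + √((1 + 4a² − a⁴)² + 4a²(1 − a²)²)) / (2a²(1 − a²)²) and U(a) = (1/a²)·(1/(2a) − 1). Then there exists a₀ with 0 < a₀ < 1 such that for all a with 0 < a < a₀ one has L(a) < U(a); in particular, for such a there exists P > 0 with L(a) < P < U(a). -/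
noncomputable def U (a : ℝ) : ℝ := (1 / a ^ 2) * (1 / (2 * a) - 1)

lemma L_nonneg {a : ℝ} (ha : 0 < a) (h : a < 1 / 10) : 0 ≤ L a := by
  have hsq : a ^ 2 < 1 / 100 := by nlinarith
  have hnum : 0 ≤ 1 + 4 * a ^ 2 - a ^ 4 := by nlinarith [sq_nonneg a]
  unfold L
  positivity

lemma L_lt_three_div_sq {a : ℝ} (ha : 0 < a) (h : a < 1 / 10) : L a < 3 / a ^ 2 := by
  have hsq : a ^ 2 < 1 / 100 := by nlinarith
  have hpos : 0 < a ^ 2 := by positivity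
  have hx : 1 + 4 * a ^ 2 - a ^ 4 < 11 / 10 := by nlinarith
  have hx₀ : 0 < 1 + 4 * a ^ 2 - a ^ 4 := by nlinarith
  have hy : (1 - a ^ 2) ^ 2 ≤ 1 := by nlinarith
  have hy₀ : 9 / 10 < (1 - a ^ 2) ^ 2 := by nlinarith
  have hsqrt : √((1 + 4 * a ^ 2 - a ^ 4) ^ 2 + 4 * a ^ 2 * (1 - a ^ 2) ^ 2) ≤ 2 := by
    apply Real.sqrt_le_iff.mpr
    constructor <;> nlinarith
  unfold L
  rw [div_lt_div_iff₀ (by positivity) hpos]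
  nlinarith

lemma three_div_sq_lt_U {a : ℝ} (ha : 0 < a) (h : a < 1 / 10) : 3 / a ^ 2 < U a := by
  have hinv : 4 < 1 / (2 * a) := by
    rw [lt_div_iff₀ (by positivity)]
    linarith
  have hpos : 0 < 1 / a ^ 2 := by positivity
  unfold U
  rw [div_eq_mul_one_div, mul_comm]
  exact mul_lt_mul_of_pos_left (by linarith) hpos

/-- For all sufficiently small `a ∈ (0,1)`, the threshold `L a` lies strictly
below the noisy-interference power limit `U a`; in particular a power `P`
with `L a < P < U a` exists. -/
theorem stmt_8 :
    ∃ a₀ : ℝ, 0 < a₀ ∧ a₀ < 1 ∧ ∀ a : ℝ, 0 < a → a < a₀ →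
      L a < U a ∧ ∃ P : ℝ, 0 < P ∧ L a < P ∧ P < U a := by
  refine ⟨1 / 10, by norm_num, by norm_num, fun a ha h => ?_⟩
  have hL := L_lt_three_div_sq ha h
  have hU := three_div_sq_lt_U ha h
  exact ⟨hL.trans hU, 3 / a ^ 2, (L_nonneg ha h).trans_lt hL, hL, hU⟩
end

section
/- There exists a₀ with 0 < a₀ < 1 such that for every a with 0 < a < a₀ there exists P > 0 satisfying simultaneously: (i) a·(a²·P + 1) ≤ 1/2, and (ii) (1 − a²)²·P²/((1 + a²)·2P + 1) > P/(1 + a²·P). Consequently, for such a and P the out-of-phase amplify-and-forward end-to-end symmetric rate γ((1−a²)²P²/(2(1+a²)P+1)) strictly exceeds γ(P/(1+a²P)), the symmetric capacity of each individual hop. -/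
theorem gamma_lt_gamma {x y : ℝ} (hx : 0 ≤ x) (hxy : x < y) : gamma x < gamma y := by
  have h : Real.log (1 + x) < Real.log (1 + y) := Real.log_lt_log (by linarith) (by linarith)
  unfold gamma
  linarith

/-- For all sufficiently small interference gains `a ∈ (0, 1)` there is a power
`P > 0` satisfying the noisy-interference condition `a(a²P + 1) ≤ 1/2` for
which the out-of-phase amplify-and-forward end-to-end symmetric rate strictly
exceeds the symmetric capacity of each single hop. -/
theorem stmt_11 :
    ∃ a₀ : ℝ, 0 < a₀ ∧ a₀ < 1 ∧ ∀ a : ℝ, 0 < a → a < a₀ →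
      ∃ P : ℝ, 0 < P ∧
        a * (a ^ 2 * P + 1) ≤ 1 / 2 ∧
        (1 - a ^ 2) ^ 2 * P ^ 2 / ((1 + a ^ 2) * (2 * P) + 1)
          > P / (1 + a ^ 2 * P) ∧
        gamma ((1 - a ^ 2) ^ 2 * P ^ 2 / (2 * (1 + a ^ 2) * P + 1))
          > gamma (P / (1 + a ^ 2 * P)) := by
  refine ⟨1 / 6, by norm_num, by norm_num, fun a ha ha' => ?_⟩
  obtain ⟨P, hP, haP⟩ : ∃ P : ℝ, 0 < P ∧ a ^ 2 * P = 2 :=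
    ⟨2 / a ^ 2, by positivity, by field_simp⟩
  have hsq : a ^ 2 < 1 / 36 := by nlinarith
  have hP72 : 72 < P := by nlinarith
  have hrate : P / (1 + a ^ 2 * P)
      < (1 - a ^ 2) ^ 2 * P ^ 2 / ((1 + a ^ 2) * (2 * P) + 1) := by
    have hexpand : (1 - a ^ 2) ^ 2 * P = P - 4 + 2 * a ^ 2 := by
      linear_combination (a ^ 2 - 2) * haP
    have hlin : (1 + a ^ 2) * (2 * P) + 1 < (1 - a ^ 2) ^ 2 * P * 3 := by
      rw [hexpand]
      nlinarith [sq_nonneg a]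
    rw [haP, div_lt_div_iff₀ (by norm_num) (by positivity)]
    nlinarith [mul_lt_mul_of_pos_left hlin hP]
  refine ⟨P, hP, by rw [haP]; linarith, hrate, gamma_lt_gamma (by positivity) ?_⟩
  rwa [show 2 * (1 + a ^ 2) * P = (1 + a ^ 2) * (2 * P) by ring]
end
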